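/- Let n ≥ 7 and let G and H be simple graphs on n vertices that share n−1 cards. If r is an integer with 1 ≤ r and 2^r ≤ n (i.e., r ≤ log₂ n), then κ_r(G) = κ_r(H). -/

import Mathlib

open SimpleGraph

/-- `kappa G r` is the number of `r`-cliques of the graph `G`. -/
noncomputable def kappa {V : Type*} (G : SimpleGraph V) (r : ℕ) : ℕ :=
  (G.cliqueSet r).ncard

/-- `degR G r v` is the number of `r`-cliques of `G` that contain the vertex `v`. -/
noncomputable def degR {V : Type*} (G : SimpleGraph V) (r : ℕ) (v : V) : ℕ :=
  {s | s ∈ G.cliqueSet r ∧ v ∈ s}.ncard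

/-- `deg G v` is the degree of the vertex `v` in `G`. -/
noncomputable def deg {V : Type*} (G : SimpleGraph V) (v : V) : ℕ :=
  (G.neighborSet v).ncard

/-- `gcard G v` is the card `G - v`: the induced subgraph of `G` on `V(G) \ {v}`. -/
def gcard {V : Type*} (G : SimpleGraph V) (v : V) : SimpleGraph {x : V // x ≠ v} :=
  G.induce {x : V | x ≠ v}

/-- The maximum degree `Δ(G)`. -/
noncomputable def maxDeg {n : ℕ} (G : SimpleGraph (Fin n)) : ℕ :=
  Finset.univ.sup (fun v => deg G v)

/-- The minimum degree `δ(G)`. -/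
noncomputable def minDeg {n : ℕ} (G : SimpleGraph (Fin n)) : ℕ :=
  sInf (Set.range (fun v => deg G v))

/-- `ℓ(G)`: the number of vertices of maximum degree. -/
noncomputable def numMaxDeg {n : ℕ} (G : SimpleGraph (Fin n)) : ℕ :=
  (Finset.univ.filter (fun v => deg G v = maxDeg G)).card

/-- `G` and `H` share `n-1` cards via the vertices `u`, `w` and the bijection `π`:
for every `v ≠ u`, the card `G - v` is isomorphic to the card `H - π(v)`. -/
def ShareCardsVia {n : ℕ} (G H : SimpleGraph (Fin n)) (u w : Fin n)
    (π : {x : Fin n // x ≠ u} ≃ {y : Fin n // y ≠ w}) : Prop :=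
  ∀ v : {x : Fin n // x ≠ u}, Nonempty (gcard G v.1 ≃g gcard H (π v).1)

/-- `G` and `H` share `n-1` cards. -/
def ShareCards {n : ℕ} (G H : SimpleGraph (Fin n)) : Prop :=
  ∃ (u w : Fin n) (π : {x : Fin n // x ≠ u} ≃ {y : Fin n // y ≠ w}),
    ShareCardsVia G H u w π

section Aux
set_option linter.unusedSectionVars false
open scoped Classical
open Finset

variable {V : Type*} [Fintype V]

/-- the finset of `r`-cliques -/
noncomputable def clq (G : SimpleGraph V) (r : ℕ) : Finset (Finset V) :=
  univ.filter (fun s => G.IsNClique r s)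

/-- number of `r`-cliques through a vertex -/
noncomputable def fd (G : SimpleGraph V) (r : ℕ) (v : V) : ℕ :=
  ((clq G r).filter (fun s => v ∈ s)).card

/-- degree -/
noncomputable def dg (G : SimpleGraph V) (v : V) : ℕ :=
  (univ.filter (fun x => G.Adj v x)).card

/-- the cards at `v` and `v'` are isomorphic -/
def CI (G H : SimpleGraph V) (v v' : V) : Prop :=
  ∃ τ : V ≃ V, τ v = v' ∧ ∀ x y, x ≠ v → y ≠ v → (G.Adj x y ↔ H.Adj (τ x) (τ y))

lemma CI.symm {G H : SimpleGraph V} {v v' : V} (h : CI G H v v') : CI H G v' v := by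
  obtain ⟨τ, h1, h2⟩ := h
  refine ⟨τ.symm, by rw [← h1]; simp, fun x y hx hy => ?_⟩
  have := h2 (τ.symm x) (τ.symm y) (by rintro rfl; simp at h1; exact hx h1) (by rintro rfl; simp at h1; exact hy h1)
  simpa using this.symm

lemma mem_clq {G : SimpleGraph V} {r : ℕ} {s : Finset V} :
    s ∈ clq G r ↔ (∀ x ∈ s, ∀ y ∈ s, x ≠ y → G.Adj x y) ∧ s.card = r := by
  simp only [clq, mem_filter, mem_univ, true_and, SimpleGraph.isNClique_iff, SimpleGraph.IsClique,
    Set.Pairwise, mem_coe]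

lemma map_mem_clq {G H : SimpleGraph V} {r : ℕ} {s : Finset V} (τ : V ≃ V)
    (h : ∀ x ∈ s, ∀ y ∈ s, (G.Adj x y ↔ H.Adj (τ x) (τ y))) :
    s ∈ clq G r ↔ s.map τ.toEmbedding ∈ clq H r := by
  rw [mem_clq, mem_clq]
  simp only [mem_map, Equiv.coe_toEmbedding, card_map, forall_exists_index, and_imp,
    forall_apply_eq_imp_iff₂]
  refine and_congr_left fun _ => ?_
  constructor
  · intro h1 x hx y hy hxy
    exact (h x hx y hy).1 (h1 x hx y hy (fun e => hxy (by rw [e])))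
  · intro h1 x hx y hy hxy
    exact (h x hx y hy).2 (h1 x hx y hy (fun e => hxy (τ.injective e)))

lemma sum_fd (G : SimpleGraph V) (r : ℕ) : ∑ v, fd G r v = r * (clq G r).card := by
  unfold fd
  simp_rw [card_filter]
  rw [sum_comm]
  rw [sum_congr rfl (g := fun _ => r)]
  · simp [mul_comm]
  · intro s hs
    rw [← card_filter]
    simpa using (mem_clq.1 hs).2

lemma card_iso {G H : SimpleGraph V} (τ : V ≃ V) (h : ∀ x y, (G.Adj x y ↔ H.Adj (τ x) (τ y)))
    (r : ℕ) : (clq G r).card = (clq H r).card :=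
  card_equiv τ.finsetCongr (fun s => by
    simpa using map_mem_clq τ (fun x _ y _ => h x y))

lemma fd_iso {G H : SimpleGraph V} (τ : V ≃ V) (h : ∀ x y, (G.Adj x y ↔ H.Adj (τ x) (τ y)))
    (r : ℕ) (x : V) : fd G r x = fd H r (τ x) :=
  card_equiv τ.finsetCongr (fun s => by
    simp only [mem_filter, Equiv.finsetCongr_apply]
    rw [map_mem_clq τ (fun x _ y _ => h x y)]
    simp)

lemma CI.card_clq {G H : SimpleGraph V} {v v' : V} (h : CI G H v v') (r : ℕ) :
    (clq G r).card + fd H r v' = (clq H r).card + fd G r v := by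
  obtain ⟨τ, h1, h2⟩ := h
  have e : ((clq G r).filter (fun s => ¬ v ∈ s)).card = ((clq H r).filter (fun s => ¬ v' ∈ s)).card := by
    refine card_equiv τ.finsetCongr (fun s => ?_)
    simp only [mem_filter, Equiv.finsetCongr_apply]
    have : v' ∈ s.map τ.toEmbedding ↔ v ∈ s := by rw [← h1]; simp
    rw [this]
    refine and_congr_left fun hv => map_mem_clq τ (fun x hx y hy => h2 x y ?_ ?_)
    · rintro rfl; exact hv hx
    · rintro rfl; exact hv hy
  have a := card_filter_add_card_filter_not (s := clq G r) (fun s => v ∈ s)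
  have b := card_filter_add_card_filter_not (s := clq H r) (fun s => v' ∈ s)
  unfold fd
  omega

lemma fd_card_eq {G H : SimpleGraph V} {v : V} {r : ℕ} {τ : V ≃ V}
    (h2 : ∀ x y, x ≠ v → y ≠ v → (G.Adj x y ↔ H.Adj (τ x) (τ y))) {x : V} (hx : x ≠ v)
    (hG : ¬ G.Adj x v) (hH : ¬ H.Adj (τ x) (τ v)) : fd G r x = fd H r (τ x) := by
  refine card_equiv τ.finsetCongr (fun s => ?_)
  simp only [mem_filter, Equiv.finsetCongr_apply]
  have hm : τ x ∈ s.map τ.toEmbedding ↔ x ∈ s := by simp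
  rw [hm]
  refine and_congr_left fun hxs => ?_
  by_cases hv : v ∈ s
  · constructor
    · intro h; exact absurd ((mem_clq.1 h).1 x hxs v hv hx) hG
    · intro h; exact absurd ((mem_clq.1 h).1 (τ x) (by simpa using hxs) (τ v) (by simpa using hv)
        (fun e => hx (τ.injective e))) hH
  · refine map_mem_clq τ (fun a ha y hy => h2 a y ?_ ?_)
    · rintro rfl; exact hv ha
    · rintro rfl; exact hv hy

lemma dg_card_eq {G H : SimpleGraph V} {v : V} {τ : V ≃ V}
    (h2 : ∀ x y, x ≠ v → y ≠ v → (G.Adj x y ↔ H.Adj (τ x) (τ y))) {x : V} (hx : x ≠ v) :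
    dg G x + (if H.Adj (τ x) (τ v) then 1 else 0) = dg H (τ x) + (if G.Adj x v then 1 else 0) := by
  have e : ((univ.filter (fun y => G.Adj x y)).filter (fun y => y ≠ v)).card =
      ((univ.filter (fun y => H.Adj (τ x) y)).filter (fun y => y ≠ τ v)).card := by
    refine card_equiv τ (fun y => ?_)
    simp only [mem_filter, mem_univ, true_and, ne_eq, EmbeddingLike.apply_eq_iff_eq]
    exact and_congr_left fun hy => h2 x y hx hy
  have key : ∀ (K : SimpleGraph V) (a b : V), dg K a =
      ((univ.filter (fun y => K.Adj a y)).filter (fun y => y ≠ b)).card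
        + if K.Adj a b then 1 else 0 := by
    intro K a b
    have := card_filter_add_card_filter_not (s := univ.filter (fun y => K.Adj a y)) (fun y => y ≠ b)
    unfold dg
    rw [← this]
    congr 1
    split_ifs with hab
    · rw [card_eq_one]; exact ⟨b, by ext y; simp; rintro rfl; exact hab⟩
    · rw [card_eq_zero]; ext y; simp; rintro h rfl; exact hab h
  have h3 := key G x v
  have h4 := key H (τ x) (τ v)
  omega

lemma dg_eq_fd (G : SimpleGraph V) (v : V) : dg G v = fd G 2 v := by
  unfold dg fd
  refine card_bij (fun y _ => {v, y}) ?_ ?_ ?_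
  · intro y hy
    have hy : G.Adj v y := by simpa using hy
    rw [mem_filter, mem_clq]
    refine ⟨⟨?_, card_pair hy.ne⟩, by simp⟩
    intro a ha b hb hab
    simp only [mem_insert, mem_singleton] at ha hb
    rcases ha with rfl | rfl <;> rcases hb with rfl | rfl
    · exact absurd rfl hab
    · exact hy
    · exact hy.symm
    · exact absurd rfl hab
  · intro a ha b hb h
    have ha : G.Adj v a := by simpa using ha
    have hb : G.Adj v b := by simpa using hb
    have : a ∈ ({v, b} : Finset V) := by rw [← h]; simp
    simp only [mem_insert, mem_singleton] at this
    rcases this with rfl | h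
    · exact absurd rfl ha.ne
    · exact h
  · intro s hs
    rw [mem_filter, mem_clq] at hs
    obtain ⟨⟨h1, h2⟩, h3⟩ := hs
    obtain ⟨a, b, hab, rfl⟩ := card_eq_two.1 h2
    simp only [mem_insert, mem_singleton] at h3
    rcases h3 with rfl | rfl
    · exact ⟨b, by simpa using h1 v (by simp) b (by simp) hab, rfl⟩
    · exact ⟨a, by simpa using h1 v (by simp) a (by simp) hab.symm, pair_comm _ _⟩

/-- `fd r x + fd (r-1) x` plus `(r-1)`-cliques through a nonneighbour. -/
lemma fd_succ_dom (G : SimpleGraph V) (r : ℕ) (x : V) (h : ∀ y, y ≠ x → G.Adj x y) :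
    fd G (r + 1) x + fd G r x = (clq G r).card := by
  have hA := card_filter_add_card_filter_not (s := clq G r) (fun s => x ∈ s)
  have b : fd G (r + 1) x = ((clq G r).filter (fun s => ¬ x ∈ s)).card := by
    unfold fd
    refine card_bij' (fun s _ => s.erase x) (fun s _ => insert x s) ?_ ?_ ?_ ?_
    · intro s hs
      rw [mem_filter, mem_clq] at hs
      rw [mem_filter, mem_clq]
      refine ⟨⟨fun a ha b hb => hs.1.1 a (mem_of_mem_erase ha) b (mem_of_mem_erase hb), ?_⟩, by simp⟩
      rw [card_erase_of_mem hs.2, hs.1.2]; rfl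
    · intro s hs
      rw [mem_filter, mem_clq] at hs
      rw [mem_filter, mem_clq]
      refine ⟨⟨?_, by rw [card_insert_of_notMem hs.2, hs.1.2]⟩, by simp⟩
      intro a ha b hb hab
      rw [mem_insert] at ha hb
      rcases ha with rfl | ha <;> rcases hb with rfl | hb
      · exact absurd rfl hab
      · exact h b hab.symm
      · exact (h a hab).symm
      · exact hs.1.1 a ha b hb hab
    · intro s hs; exact insert_erase (mem_filter.1 hs).2
    · intro s hs; exact erase_insert (mem_filter.1 hs).2
  rw [b]; unfold fd; omega

lemma fd_succ_co (G : SimpleGraph V) (r : ℕ) (x z : V) (hz : z ≠ x) (hxz : ¬ G.Adj x z)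
    (h : ∀ y, y ≠ x → y ≠ z → G.Adj x y) :
    fd G (r + 1) x + fd G r x + fd G r z = (clq G r).card := by
  have hA := card_filter_add_card_filter_not (s := clq G r) (fun s => x ∈ s)
  have hA' := card_filter_add_card_filter_not (s := (clq G r).filter (fun s => ¬ x ∈ s)) (fun s => z ∈ s)
  have c : fd G r z = (((clq G r).filter (fun s => ¬ x ∈ s)).filter (fun s => z ∈ s)).card := by
    unfold fd
    congr 1
    ext s
    simp only [mem_filter]
    constructor
    · rintro ⟨h1, h2⟩
      exact ⟨⟨h1, fun hx => hxz ((mem_clq.1 h1).1 x hx z h2 hz.symm)⟩, h2⟩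
    · rintro ⟨⟨h1, _⟩, h2⟩; exact ⟨h1, h2⟩
  have b : fd G (r + 1) x = (((clq G r).filter (fun s => ¬ x ∈ s)).filter (fun s => ¬ z ∈ s)).card := by
    unfold fd
    refine card_bij' (fun s _ => s.erase x) (fun s _ => insert x s) ?_ ?_ ?_ ?_
    · intro s hs
      rw [mem_filter, mem_clq] at hs
      rw [mem_filter, mem_filter, mem_clq]
      refine ⟨⟨⟨fun a ha b hb => hs.1.1 a (mem_of_mem_erase ha) b (mem_of_mem_erase hb), ?_⟩, by simp⟩, ?_⟩
      · rw [card_erase_of_mem hs.2, hs.1.2]; rfl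
      · intro h'
        exact hxz (hs.1.1 x hs.2 z (mem_of_mem_erase h') hz.symm)
    · intro s hs
      rw [mem_filter, mem_filter, mem_clq] at hs
      rw [mem_filter, mem_clq]
      refine ⟨⟨?_, by rw [card_insert_of_notMem hs.1.2, hs.1.1.2]⟩, by simp⟩
      intro a ha b hb hab
      rw [mem_insert] at ha hb
      rcases ha with rfl | ha <;> rcases hb with rfl | hb
      · exact absurd rfl hab
      · exact h b hab.symm (by rintro rfl; exact hs.2 hb)
      · exact (h a hab (by rintro rfl; exact hs.2 ha)).symm
      · exact hs.1.1.1 a ha b hb hab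
    · intro s hs; exact insert_erase (mem_filter.1 hs).2
    · intro s hs; exact erase_insert (mem_filter.1 (mem_filter.1 hs).1).2
  rw [b, c]; unfold fd; omega

/-- shared cards, with a full bijection -/
def Sh (G H : SimpleGraph V) (σ : V ≃ V) (u : V) : Prop := ∀ v, v ≠ u → CI G H v (σ v)

lemma Sh.symm {G H : SimpleGraph V} {σ : V ≃ V} {u : V} (h : Sh G H σ u) :
    Sh H G σ.symm (σ u) := by
  intro v hv
  have := h (σ.symm v) (by rintro rfl; simp at hv)
  simpa using this.symm

lemma Sh.fd_diff {G H : SimpleGraph V} {σ : V ≃ V} {u : V} (h : Sh G H σ u) (r : ℕ) {k : ℤ}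
    (hk : ((clq G r).card : ℤ) = (clq H r).card + k) :
    (∀ v, v ≠ u → (fd G r v : ℤ) = fd H r (σ v) + k) ∧
      (fd H r (σ u) : ℤ) = fd G r u + ((Fintype.card V : ℤ) - r - 1) * k := by
  have h1 : ∀ v, v ≠ u → (fd G r v : ℤ) = fd H r (σ v) + k := by
    intro v hv
    have := (h v hv).card_clq r
    zify at this
    linarith
  refine ⟨h1, ?_⟩
  have a := sum_fd G r
  have b := sum_fd H r
  rw [← Equiv.sum_comp σ] at b
  rw [← add_sum_erase _ _ (mem_univ u)] at a b
  zify at a b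
  rw [sum_congr rfl (fun v hv => h1 v (ne_of_mem_erase hv)), sum_add_distrib] at a
  simp only [sum_const, card_erase_of_mem (mem_univ u), card_univ, nsmul_eq_mul] at a
  have hp : 1 ≤ Fintype.card V := Fintype.card_pos_iff.2 ⟨u⟩
  push_cast [hp] at a
  rw [hk] at a
  linarith

/-- nonneighbours of `v` of degree `Δ` -/
noncomputable def NN (G : SimpleGraph V) (Δ : ℕ) (v : V) : Finset V :=
  univ.filter (fun x => dg G x = Δ ∧ x ≠ v ∧ ¬ G.Adj x v)

lemma mem_NN {G : SimpleGraph V} {Δ : ℕ} {v x : V} :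
    x ∈ NN G Δ v ↔ dg G x = Δ ∧ x ≠ v ∧ ¬ G.Adj x v := by simp [NN]

lemma dg_compl (G : SimpleGraph V) (x : V) :
    dg G x + (univ.filter (fun v => v ≠ x ∧ ¬ G.Adj x v)).card + 1 = Fintype.card V := by
  have a := card_filter_add_card_filter_not (s := (univ : Finset V)) (fun v => G.Adj x v)
  have b := card_filter_add_card_filter_not (s := univ.filter (fun v => ¬ G.Adj x v)) (fun v => v ≠ x)
  have c : ((univ.filter (fun v => ¬ G.Adj x v)).filter (fun v => ¬ v ≠ x)) = {x} := by
    ext y; simp; rintro rfl; simp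
  have d : ((univ.filter (fun v => ¬ G.Adj x v)).filter (fun v => v ≠ x)) =
      (univ.filter (fun v => v ≠ x ∧ ¬ G.Adj x v)) := by
    ext y; simp [and_comm]
  rw [c, d, card_singleton] at b
  rw [card_univ] at a
  unfold dg
  omega

lemma sum_NN (G : SimpleGraph V) (Δ : ℕ) (p : V → Prop) [DecidablePred p] :
    ∑ v, ((NN G Δ v).filter p).card =
      (univ.filter (fun x => dg G x = Δ ∧ p x)).card * (Fintype.card V - 1 - Δ) := by
  have h1 : ∀ v, ((NN G Δ v).filter p) =
      (univ.filter (fun x => dg G x = Δ ∧ p x)).filter (fun x => v ≠ x ∧ ¬ G.Adj x v) := by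
    intro v; ext x; simp only [mem_filter, mem_NN, mem_univ, true_and]
    constructor
    · rintro ⟨⟨a, b, c⟩, d⟩; exact ⟨⟨a, d⟩, b.symm, c⟩
    · rintro ⟨⟨a, d⟩, b, c⟩; exact ⟨⟨a, b.symm, c⟩, d⟩
  simp_rw [h1, card_filter _ (univ.filter _)]
  rw [sum_comm, sum_congr rfl (g := fun _ => Fintype.card V - 1 - Δ)]
  · simp
  · intro x hx
    rw [← card_filter]
    have := dg_compl G x
    simp only [mem_filter, mem_univ, true_and] at hx
    omega

lemma CI.nn {G H : SimpleGraph V} {v v' : V} (h : CI G H v v') {Δ : ℕ}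
    (hG : ∀ x, dg G x ≤ Δ) (hH : ∀ x, dg H x ≤ Δ) :
    ∃ τ : V ≃ V, τ v = v' ∧ (∀ x y, x ≠ v → y ≠ v → (G.Adj x y ↔ H.Adj (τ x) (τ y))) ∧
      (∀ x, x ∈ NN G Δ v ↔ τ x ∈ NN H Δ v') ∧
      ∀ x ∈ NN G Δ v, ∀ r, fd G r x = fd H r (τ x) := by
  obtain ⟨τ, rfl, h2⟩ := h
  have key : ∀ x, x ∈ NN G Δ v ↔ τ x ∈ NN H Δ (τ v) := by
    intro x
    rw [mem_NN, mem_NN]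
    by_cases hx : x = v
    · subst hx; simp
    have h3 := dg_card_eq h2 hx
    have h4 := hG x
    have h5 := hH (τ x)
    have h6 : τ x ≠ τ v := fun e => hx (τ.injective e)
    constructor
    · rintro ⟨a, b, c⟩
      rw [if_neg c] at h3
      by_cases hc : H.Adj (τ x) (τ v)
      · rw [if_pos hc] at h3; omega
      · rw [if_neg hc] at h3; exact ⟨by omega, h6, hc⟩
    · rintro ⟨a, b, c⟩
      rw [if_neg c] at h3
      by_cases hc : G.Adj x v
      · rw [if_pos hc] at h3; omega
      · rw [if_neg hc] at h3; exact ⟨by omega, hx, hc⟩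
  refine ⟨τ, rfl, h2, key, fun x hx r => ?_⟩
  have h7 := mem_NN.1 hx
  have h8 := mem_NN.1 ((key x).1 hx)
  exact fd_card_eq h2 h7.2.1 h7.2.2 h8.2.2

lemma CI.nn_card {G H : SimpleGraph V} {v v' : V} (h : CI G H v v') {Δ : ℕ}
    (hG : ∀ x, dg G x ≤ Δ) (hH : ∀ x, dg H x ≤ Δ) :
    (NN G Δ v).card = (NN H Δ v').card ∧ ∀ r θ, ((NN G Δ v).filter (fun x => fd G r x = θ)).card =
      ((NN H Δ v').filter (fun x => fd H r x = θ)).card := by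
  obtain ⟨τ, h1, h2, h3, h4⟩ := h.nn hG hH
  refine ⟨card_equiv τ h3, fun r θ => card_equiv τ fun x => ?_⟩
  rw [mem_filter, mem_filter, ← h3]
  exact and_congr_right fun hx => by rw [h4 x hx]

/-- hypotheses for the inductive step (`r = q + 1`) -/
structure St (G H : SimpleGraph V) (σ : V ≃ V) (u : V) (q k N Δ : ℕ) : Prop where
  sh : Sh G H σ u
  kpos : 0 < k
  Npos : 0 < N
  hn : Fintype.card V = N + (q + 1) + 1
  hf : ∀ v, v ≠ u → fd G (q + 1) v = fd H (q + 1) (σ v) + k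
  hfu : fd H (q + 1) (σ u) = fd G (q + 1) u + N * k
  hd : ∀ v, dg H (σ v) = dg G v
  hg : ∀ v, fd H q (σ v) = fd G q v
  hc : (clq G q).card = (clq H q).card
  hne : (clq G (q + 1)).card ≠ (clq H (q + 1)).card
  hle : ∀ v, dg G v ≤ Δ
  hex : ∃ v, dg G v = Δ

section step
variable {G H : SimpleGraph V} {σ : V ≃ V} {u : V} {q k N Δ : ℕ}

lemma St.hle' (S : St G H σ u q k N Δ) : ∀ v, dg H v ≤ Δ := by
  intro v
  have := S.hd (σ.symm v)
  have := S.hle (σ.symm v)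
  simp_all

lemma St.m1 (S : St G H σ u q k N Δ) {v x : V} (hv : v ≠ u) (hx : x ∈ NN G Δ v) :
    ∃ y ∈ NN H Δ (σ v), ∀ r, fd H r y = fd G r x := by
  obtain ⟨τ, h1, h2, h3, h4⟩ := (S.sh v hv).nn S.hle S.hle'
  exact ⟨τ x, (h3 x).1 hx, fun r => (h4 x hx r).symm⟩

lemma St.m1' (S : St G H σ u q k N Δ) {v y : V} (hv : v ≠ u) (hy : y ∈ NN H Δ (σ v)) :
    ∃ x ∈ NN G Δ v, ∀ r, fd H r y = fd G r x := by
  obtain ⟨τ, h1, h2, h3, h4⟩ := (S.sh v hv).nn S.hle S.hle'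
  have : τ.symm y ∈ NN G Δ v := by rw [h3]; simpa using hy
  exact ⟨τ.symm y, this, fun r => by rw [h4 _ this]; simp⟩

lemma St.dcard (S : St G H σ u q k N Δ) (p : V → Prop) [DecidablePred p] :
    (univ.filter (fun x => dg H x = Δ ∧ p x)).card =
      (univ.filter (fun x => dg G x = Δ ∧ p (σ x))).card := by
  refine (card_equiv σ fun x => ?_).symm
  simp [S.hd]

lemma St.m2 (S : St G H σ u q k N Δ) (v : V) : (NN G Δ v).card = (NN H Δ (σ v)).card := by
  by_cases hv : v = u
  · subst hv
    have h1 := sum_NN G Δ (fun _ => True)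
    have h2 := sum_NN H Δ (fun _ => True)
    rw [S.dcard, ← h1] at h2
    simp only [filter_true] at h2
    rw [← Equiv.sum_comp σ, ← add_sum_erase _ _ (mem_univ v), ← add_sum_erase _ _ (mem_univ v)] at h2
    rw [sum_congr rfl (fun x hx => ((S.sh x (ne_of_mem_erase hx)).nn_card S.hle S.hle').1.symm)] at h2
    omega
  · exact ((S.sh v hv).nn_card S.hle S.hle').1

lemma St.allD (S : St G H σ u q k N Δ) {v : V} (h : ∀ x, x ≠ v → ¬ G.Adj x v → dg G x = Δ) :
    ∀ x, x ≠ σ v → ¬ H.Adj x (σ v) → dg H x = Δ := by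
  have h1 := dg_compl G v
  have h2 := dg_compl H (σ v)
  have h3 := S.m2 v
  rw [S.hd] at h2
  have h4 : NN G Δ v = univ.filter (fun x => x ≠ v ∧ ¬ G.Adj v x) := by
    ext x; rw [mem_NN]; simp only [mem_filter, mem_univ, true_and]
    rw [G.adj_comm v x]
    exact ⟨fun a => a.2, fun a => ⟨h x a.1 a.2, a⟩⟩
  have h5 : NN H Δ (σ v) ⊆ univ.filter (fun x => x ≠ σ v ∧ ¬ H.Adj (σ v) x) := by
    intro x hx; rw [mem_NN] at hx; simp only [mem_filter, mem_univ, true_and]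
    rw [H.adj_comm (σ v) x]
    exact hx.2
  have h6 := eq_of_subset_of_card_le h5 (by rw [← h3, h4]; omega)
  intro x hx hx'
  have : x ∈ NN H Δ (σ v) := by
    rw [h6]; simp only [mem_filter, mem_univ, true_and]
    rw [H.adj_comm (σ v) x]; exact ⟨hx, hx'⟩
  exact (mem_NN.1 this).1

lemma St.m3 (S : St G H σ u q k N Δ) {v : V} (hv : v ≠ u) :
    ∃ x, x ≠ v ∧ ¬ G.Adj x v ∧ dg G x ≠ Δ := by
  by_contra hcon
  push Not at hcon
  have hcon' := S.allD hcon
  obtain ⟨τ, h1, h2, h3, h4⟩ := (S.sh v hv).nn S.hle S.hle'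
  have h5 : ∀ x, (G.Adj x v ↔ H.Adj (τ x) (τ v)) := by
    intro x
    by_cases hx : x = v
    · subst hx; simp
    have hx' : τ x ≠ σ v := fun e => hx (τ.injective (by rw [e, h1]))
    rw [h1]
    rw [← not_iff_not]
    constructor
    · intro h; exact (mem_NN.1 ((h3 x).1 (mem_NN.2 ⟨hcon x hx h, hx, h⟩))).2.2
    · intro h; exact (mem_NN.1 ((h3 x).2 (mem_NN.2 ⟨hcon' _ hx' h, hx', h⟩))).2.2
  refine S.hne (card_iso τ (fun x y => ?_) _)
  by_cases hy : y = v
  · subst hy; exact h5 x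
  by_cases hx : x = v
  · subst hx; rw [G.adj_comm, H.adj_comm]; exact h5 y
  exact h2 x y hx hy

lemma St.caseA (S : St G H σ u q k N Δ) (hu : dg G u ≠ Δ) : False := by
  obtain ⟨x, hx, hmax⟩ := exists_max_image (univ.filter (fun x => dg G x = Δ)) (fd G (q + 1))
    (by obtain ⟨v, hv⟩ := S.hex; exact ⟨v, by simpa using hv⟩)
  simp only [mem_filter, mem_univ, true_and] at hx hmax
  have hxu : x ≠ u := by rintro rfl; exact hu hx
  have h1 : ∀ v, v ≠ u → v ≠ x → G.Adj x v := by
    intro v hv hvx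
    by_contra hadj
    obtain ⟨y, hy, hfy⟩ := S.m1 hv (mem_NN.2 ⟨hx, hvx.symm, hadj⟩)
    obtain ⟨x', rfl⟩ := σ.surjective y
    have h3 := (mem_NN.1 hy).1
    rw [S.hd] at h3
    have h4 : x' ≠ u := by rintro rfl; exact hu h3
    have := hmax x' h3
    have := S.hf x' h4
    have := hfy (q + 1)
    have := S.kpos
    omega
  obtain ⟨z, hz, hzx, hzd⟩ := S.m3 hxu
  have hzu : z = u := by
    by_contra hne
    exact hzx (h1 z hne hz).symm
  subst hzu
  have hΔ : Δ + 2 = Fintype.card V := by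
    have := dg_compl G x
    have h3 : (univ.filter (fun v => v ≠ x ∧ ¬ G.Adj x v)) = {z} := by
      ext v
      simp only [mem_filter, mem_univ, true_and, mem_singleton]
      constructor
      · rintro ⟨a, b⟩; by_contra hne; exact b (h1 v hne a)
      · rintro rfl; exact ⟨hz, fun h => hzx h.symm⟩
    rw [h3, card_singleton] at this
    omega
  -- unique nonneighbours
  have uniq : ∀ (K : SimpleGraph V) (a : V), dg K a = Δ → ∃ b, b ≠ a ∧ ¬ K.Adj a b ∧
      ∀ y, y ≠ a → y ≠ b → K.Adj a y := by
    intro K a ha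
    have := dg_compl K a
    have h3 : (univ.filter (fun v => v ≠ a ∧ ¬ K.Adj a v)).card = 1 := by omega
    obtain ⟨b, hb⟩ := card_eq_one.1 h3
    have hb' : ∀ y, (y ≠ a ∧ ¬ K.Adj a y) ↔ y = b := by
      intro y
      have : y ∈ (univ.filter (fun v => v ≠ a ∧ ¬ K.Adj a v)) ↔ y ∈ ({b} : Finset V) := by rw [hb]
      simpa using this
    refine ⟨b, ((hb' b).2 rfl).1, ((hb' b).2 rfl).2, fun y hy hyb => ?_⟩
    by_contra hcon
    exact hyb ((hb' y).1 ⟨hy, hcon⟩)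
  obtain ⟨b, hb, hbmax⟩ := exists_max_image (univ.filter (fun b => (NN G Δ b).Nonempty)) (fd G q)
    (by refine ⟨z, ?_⟩
        simp only [mem_filter, mem_univ, true_and]
        exact ⟨x, mem_NN.2 ⟨hx, hz.symm, fun h => hzx h.symm⟩⟩)
  simp only [mem_filter, mem_univ, true_and] at hb hbmax
  obtain ⟨a, ha⟩ := hb
  obtain ⟨ha1, ha2, ha3⟩ := mem_NN.1 ha
  have hau : a ≠ z := by rintro rfl; exact hu ha1
  have hua : ∀ y, y ≠ a → y ≠ b → G.Adj a y := by
    obtain ⟨b', h5, h6, h7⟩ := uniq G a ha1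
    have : b = b' := by by_contra hne; exact ha3 (h7 b ha2.symm hne)
    rw [this]; exact h7
  obtain ⟨z', hz1, hz2, hz3⟩ := uniq H (σ a) (by rw [S.hd, ha1])
  have e1 := fd_succ_co G q a b ha2.symm ha3 hua
  have e2 := fd_succ_co H q (σ a) z' hz1 hz2 hz3
  obtain ⟨z'', rfl⟩ := σ.surjective z'
  have h8 : (NN G Δ z'').Nonempty := by
    rw [← card_pos, S.m2]
    exact card_pos.2 ⟨σ a, mem_NN.2 ⟨by rw [S.hd, ha1], hz1.symm, hz2⟩⟩
  have h9 := hbmax z'' h8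
  have := S.hf a hau
  have := S.hg a
  have := S.hg z''
  have := S.hc
  have := S.kpos
  omega

end step

section stepB
variable {G H : SimpleGraph V} {σ : V ≃ V} {u : V} {q k N Δ : ℕ}

lemma St.b0 (S : St G H σ u q k N Δ) (hu : dg G u = Δ) :
    ∃ x, x ≠ u ∧ ¬ G.Adj x u ∧ dg G x ≠ Δ := by
  by_contra hcon
  push Not at hcon
  have hcon' := S.allD hcon
  have hNk : 0 < N * k := Nat.mul_pos S.Npos S.kpos
  by_cases hD : ∀ x, x ≠ u → dg G x ≠ Δ
  · have h1 : ∀ y, y ≠ u → G.Adj u y := by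
      intro y hy
      by_contra h
      exact hD y hy (hcon y hy (fun h' => h h'.symm))
    have h2 : ∀ y, y ≠ σ u → H.Adj (σ u) y := by
      intro y hy
      by_contra h
      have h3 := hcon' y hy (fun h' => h h'.symm)
      obtain ⟨x, rfl⟩ := σ.surjective y
      rw [S.hd] at h3
      exact hD x (by rintro rfl; exact hy rfl) h3
    have e1 := fd_succ_dom G q u h1
    have e2 := fd_succ_dom H q (σ u) h2
    have := S.hfu
    have := S.hg u
    have := S.hc
    omega
  · push Not at hD
    obtain ⟨x0, hx0⟩ := hD
    obtain ⟨x, hx, hmax⟩ := exists_max_image (univ.filter (fun x => x ≠ u ∧ dg G x = Δ))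
      (fd G (q + 1)) ⟨x0, by simpa using hx0⟩
    simp only [mem_filter, mem_univ, true_and] at hx hmax
    obtain ⟨v, hv1, hv2, hv3⟩ := S.m3 hx.1
    have hvu : v ≠ u := by rintro rfl; exact hv3 hu
    obtain ⟨y, hy, hfy⟩ := S.m1 hvu (mem_NN.2 ⟨hx.2, hv1.symm, fun h => hv2 h.symm⟩)
    obtain ⟨x', rfl⟩ := σ.surjective y
    obtain ⟨h3, h4, h5⟩ := mem_NN.1 hy
    rw [S.hd] at h3
    have hne : x' ≠ u := by
      rintro rfl
      have := hcon' (σ v) h4.symm (fun h => h5 h.symm)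
      rw [S.hd] at this
      exact hv3 this
    have := hmax x' ⟨hne, h3⟩
    have := S.hf x' hne
    have := hfy (q + 1)
    have := S.kpos
    omega

/-- values of `fd` have equal multiplicities in `D_G` and `D_H` -/
lemma St.b1 (S : St G H σ u q k N Δ) (hu : dg G u = Δ) (θ : ℕ) :
    (univ.filter (fun x => dg G x = Δ ∧ fd G (q + 1) x = θ)).card =
      (univ.filter (fun x => dg G x = Δ ∧ fd H (q + 1) (σ x) = θ)).card := by
  obtain ⟨x, hx1, hx2, hx3⟩ := S.b0 hu
  have h1 := sum_NN G Δ (fun x => fd G (q + 1) x = θ)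
  have h2 := sum_NN H Δ (fun x => fd H (q + 1) x = θ)
  rw [S.dcard] at h2
  rw [← Equiv.sum_comp σ] at h2
  rw [← add_sum_erase _ _ (mem_univ u)] at h1 h2
  rw [sum_congr rfl (fun x hx => ((S.sh x (ne_of_mem_erase hx)).nn_card S.hle S.hle').2 (q + 1) θ)] at h1
  have hc := dg_compl G u
  have hlt : (NN G Δ u).card < (univ.filter (fun v => v ≠ u ∧ ¬ G.Adj u v)).card := by
    apply card_lt_card
    rw [ssubset_iff_of_subset]
    · refine ⟨x, ?_, fun h => hx3 (mem_NN.1 h).1⟩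
      simp only [mem_filter, mem_univ, true_and]
      exact ⟨hx1, fun h => hx2 h.symm⟩
    · intro y hy
      simp only [mem_filter, mem_univ, true_and]
      exact ⟨(mem_NN.1 hy).2.1, fun h => (mem_NN.1 hy).2.2 h.symm⟩
  have hb := card_filter_le (NN G Δ u) (fun x => fd G (q + 1) x = θ)
  have hb' := card_filter_le (NN H Δ (σ u)) (fun x => fd H (q + 1) x = θ)
  rw [← S.m2] at hb'
  have hcc : Fintype.card V - 1 - Δ = (univ.filter (fun v => v ≠ u ∧ ¬ G.Adj u v)).card := by omega
  rw [hcc] at h1 h2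
  generalize (univ.filter (fun v => v ≠ u ∧ ¬ G.Adj u v)).card = c at *
  generalize (univ.filter (fun x => dg G x = Δ ∧ fd G (q + 1) x = θ)).card = α at *
  generalize (univ.filter (fun x => dg G x = Δ ∧ fd H (q + 1) (σ x) = θ)).card = β at *
  generalize ((NN G Δ u).filter (fun x => fd G (q + 1) x = θ)).card = b at *
  generalize ((NN H Δ (σ u)).filter (fun x => fd H (q + 1) x = θ)).card = b' at *
  generalize (∑ x ∈ univ.erase u, ((NN H Δ (σ x)).filter (fun x => fd H (q + 1) x = θ)).card) = T at *
  rcases lt_trichotomy α β with h | h | h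
  · exfalso
    have : α * c + c ≤ β * c := by nlinarith
    omega
  · exact h
  · exfalso
    have : β * c + c ≤ α * c := by nlinarith
    omega

lemma St.up (S : St G H σ u q k N Δ) (hu : dg G u = Δ) {x : V} (hx : dg G x = Δ)
    (hne : fd G (q + 1) x ≠ fd H (q + 1) (σ u)) :
    ∃ y, dg G y = Δ ∧ y ≠ u ∧ fd G (q + 1) y = fd G (q + 1) x + k := by
  have h1 := S.b1 hu (fd G (q + 1) x)
  have h2 : 0 < (univ.filter (fun y => dg G y = Δ ∧ fd G (q + 1) y = fd G (q + 1) x)).card :=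
    card_pos.2 ⟨x, by simpa using hx⟩
  rw [h1] at h2
  obtain ⟨y, hy⟩ := card_pos.1 h2
  simp only [mem_filter, mem_univ, true_and] at hy
  have hyu : y ≠ u := by rintro rfl; exact hne hy.2.symm
  exact ⟨y, hy.1, hyu, by rw [S.hf y hyu, hy.2]⟩

lemma St.down (S : St G H σ u q k N Δ) (hu : dg G u = Δ) {x : V} (hx : dg G x = Δ)
    (hne : x ≠ u) :
    ∃ y, dg G y = Δ ∧ fd G (q + 1) x = fd G (q + 1) y + k := by
  have h1 := S.b1 hu (fd H (q + 1) (σ x))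
  have h2 : 0 < (univ.filter (fun y => dg G y = Δ ∧ fd H (q + 1) (σ y) = fd H (q + 1) (σ x))).card :=
    card_pos.2 ⟨x, by simpa using hx⟩
  rw [← h1] at h2
  obtain ⟨y, hy⟩ := card_pos.1 h2
  simp only [mem_filter, mem_univ, true_and] at hy
  exact ⟨y, hy.1, by rw [S.hf x hne, hy.2]⟩

lemma St.ap (S : St G H σ u q k N Δ) (hu : dg G u = Δ) :
    ∀ m, ∀ x, dg G x = Δ → fd G (q + 1) x ≤ m → ∃ j, fd G (q + 1) x = fd G (q + 1) u + j * k := by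
  intro m
  induction m with
  | zero =>
    intro x hx hm
    by_cases hxu : x = u
    · exact ⟨0, by rw [hxu]; simp⟩
    · obtain ⟨y, hy, h⟩ := S.down hu hx hxu
      have := S.kpos
      omega
  | succ m ih =>
    intro x hx hm
    by_cases hxu : x = u
    · exact ⟨0, by rw [hxu]; simp⟩
    · obtain ⟨y, hy, h⟩ := S.down hu hx hxu
      have := S.kpos
      obtain ⟨j, hj⟩ := ih y hy (by omega)
      exact ⟨j + 1, by rw [h, hj]; ring⟩

lemma St.cnt (S : St G H σ u q k N Δ) (hu : dg G u = Δ) (M : ℕ)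
    (hM : ∀ x, fd G (q + 1) x ≤ M) :
    ∀ m θ, M < θ + m → (univ.filter (fun x => dg G x = Δ ∧ fd G (q + 1) x = θ)).card ≤
      if θ ≤ fd H (q + 1) (σ u) then 1 else 0 := by
  intro m
  induction m with
  | zero =>
    intro θ hθ
    rw [card_eq_zero.2]
    · exact Nat.zero_le _
    · ext x
      have := hM x
      simp only [mem_filter, mem_univ, true_and, notMem_empty, iff_false]
      omega
  | succ m ih =>
    intro θ hθ
    have hk := S.kpos
    have h1 := ih (θ + k) (by omega)
    rw [S.b1 hu]
    have hsub : ∀ x, x ≠ u → (dg G x = Δ ∧ fd H (q + 1) (σ x) = θ) →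
        x ∈ univ.filter (fun x => dg G x = Δ ∧ fd G (q + 1) x = θ + k) := by
      intro x hx h
      simp only [mem_filter, mem_univ, true_and]
      exact ⟨h.1, by rw [S.hf x hx, h.2]⟩
    by_cases hw : θ = fd H (q + 1) (σ u)
    · rw [if_neg (by omega)] at h1
      rw [if_pos (by omega)]
      rw [card_le_one]
      have : ∀ a ∈ univ.filter (fun x => dg G x = Δ ∧ fd H (q + 1) (σ x) = θ), a = u := by
        intro a ha
        simp only [mem_filter, mem_univ, true_and] at ha
        by_contra hne
        have := card_pos.2 ⟨a, hsub a hne ha⟩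
        omega
      intro a ha b hb
      rw [this a ha, this b hb]
    · have h2 : (univ.filter (fun x => dg G x = Δ ∧ fd H (q + 1) (σ x) = θ)).card ≤
          (univ.filter (fun x => dg G x = Δ ∧ fd G (q + 1) x = θ + k)).card := by
        apply card_le_card
        intro x hx
        simp only [mem_filter, mem_univ, true_and] at hx
        exact hsub x (by rintro rfl; exact hw hx.2.symm) hx
      split_ifs at h1 ⊢ <;> omega

lemma St.bnd (S : St G H σ u q k N Δ) (hu : dg G u = Δ) (θ : ℕ) :
    (univ.filter (fun x => dg G x = Δ ∧ fd G (q + 1) x = θ)).card ≤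
      if θ ≤ fd H (q + 1) (σ u) then 1 else 0 := by
  refine S.cnt hu ((clq G (q + 1)).card) (fun x => card_filter_le _ _) ((clq G (q + 1)).card + 1) θ (by omega)

lemma St.inj (S : St G H σ u q k N Δ) (hu : dg G u = Δ) {x y : V} (hx : dg G x = Δ)
    (hy : dg G y = Δ) (h : fd G (q + 1) x = fd G (q + 1) y) : x = y := by
  have h1 := S.bnd hu (fd G (q + 1) y)
  have h2 : (univ.filter (fun x => dg G x = Δ ∧ fd G (q + 1) x = fd G (q + 1) y)).card ≤ 1 := by
    split_ifs at h1 <;> omega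
  exact card_le_one.1 h2 x (by simp [hx, h]) y (by simp [hy])

lemma St.le_w (S : St G H σ u q k N Δ) (hu : dg G u = Δ) {x : V} (hx : dg G x = Δ) :
    fd G (q + 1) x ≤ fd H (q + 1) (σ u) := by
  have h1 := S.bnd hu (fd G (q + 1) x)
  by_contra hc
  rw [if_neg hc] at h1
  have : 0 < (univ.filter (fun y => dg G y = Δ ∧ fd G (q + 1) y = fd G (q + 1) x)).card :=
    card_pos.2 ⟨x, by simpa using hx⟩
  omega

lemma St.clique (S : St G H σ u q k N Δ) (hu : dg G u = Δ) :
    ∀ m, ∀ x x', dg G x = Δ → dg G x' = Δ → x ≠ x' → ¬ G.Adj x x' →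
      fd G (q + 1) x' = fd G (q + 1) x + m * k → False := by
  intro m
  induction m using Nat.strong_induction_on with
  | _ m ih =>
    intro x x' hx hx' hne hadj hm
    have hk := S.kpos
    rcases m with _ | m
    · exact hne (S.inj hu hx hx' (by omega))
    obtain ⟨j, hj⟩ := S.ap hu _ x hx le_rfl
    have hmk : (m + 1) * k = m * k + k := by ring
    have hx'u : x' ≠ u := by
      rintro rfl; omega
    obtain ⟨y, hy, hfy⟩ := S.m1 hx'u (mem_NN.2 ⟨hx, hne, hadj⟩)
    obtain ⟨xp, rfl⟩ := σ.surjective y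
    obtain ⟨h3, h4, h5⟩ := mem_NN.1 hy
    rw [S.hd] at h3
    have hfy := hfy (q + 1)
    have hle := S.le_w hu hx'
    have hxpu : xp ≠ u := by
      rintro rfl
      omega
    have hfp := S.hf xp hxpu
    rcases m with _ | m
    · exact h4 (by rw [S.inj hu h3 hx' (by omega)])
    obtain ⟨z, hz, hfz⟩ := S.m1' hxpu (y := σ x') (mem_NN.2 ⟨by rw [S.hd, hx'], h4.symm, fun h => h5 h.symm⟩)
    obtain ⟨h6, h7, h8⟩ := mem_NN.1 hz
    have hfz := hfz (q + 1)
    have hfx' := S.hf x' hx'u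
    refine ih m (by omega) xp z h3 h6 h7.symm (fun h => h8 h.symm) ?_
    have : (m + 1) * k = m * k + k := by ring
    omega

lemma St.chain (S : St G H σ u q k N Δ) (hu : dg G u = Δ) :
    ∀ j, j ≤ N → ∃ x, dg G x = Δ ∧ fd G (q + 1) x = fd G (q + 1) u + j * k := by
  intro j
  induction j with
  | zero => intro _; exact ⟨u, hu, by simp⟩
  | succ j ih =>
    intro hj
    obtain ⟨x, hx, hfx⟩ := ih (by omega)
    have h1 : j * k < N * k := Nat.mul_lt_mul_of_pos_right (by omega) S.kpos
    obtain ⟨y, hy, _, hfy⟩ := S.up hu hx (by rw [S.hfu, hfx]; omega)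
    exact ⟨y, hy, by rw [hfy, hfx]; ring⟩

lemma St.Dbig (S : St G H σ u q k N Δ) (hu : dg G u = Δ) :
    N + 1 ≤ (univ.filter (fun x => dg G x = Δ)).card := by
  have h := S.chain hu
  have : Nonempty V := ⟨u⟩
  choose! X hX hfX using h
  have := card_le_card_of_injOn (s := range (N + 1)) (t := univ.filter (fun x => dg G x = Δ)) X
    (by intro j hj; simp only [coe_range, Set.mem_Iio] at hj; simpa using hX j (by omega))
    (by intro i hi j hj hij
        simp only [coe_range, Set.mem_Iio] at hi hj
        have a := hfX i (by omega)
        have b := hfX j (by omega)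
        have hij : X i = X j := hij
        rw [hij, b] at a
        exact (Nat.eq_of_mul_eq_mul_right S.kpos (by omega)))
  simpa using this

lemma choose_bd (r c : ℕ) (hr : 3 ≤ r) (hc : 1 ≤ c) : r + r.choose c < 2 ^ r := by
  obtain ⟨s, rfl⟩ : ∃ s, r = s + 1 := ⟨r - 1, by omega⟩
  obtain ⟨d, rfl⟩ : ∃ d, c = d + 1 := ⟨c - 1, by omega⟩
  have h1 : (s + 1).choose (d + 1) ≤ 2 ^ s := by
    rw [Nat.choose_succ_succ, ← Nat.sum_range_choose]
    by_cases hd : d + 1 ≤ s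
    · have : ∑ i ∈ ({d, d + 1} : Finset ℕ), s.choose i ≤ ∑ i ∈ range (s + 1), s.choose i := by
        apply sum_le_sum_of_subset
        intro i hi
        simp only [mem_insert, mem_singleton] at hi
        simp only [mem_range]; omega
      rwa [sum_pair (by omega)] at this
    · rw [Nat.choose_eq_zero_of_lt (show s < d + 1 by omega), add_zero]
      by_cases hd' : d ≤ s
      · exact single_le_sum (f := fun i => s.choose i) (fun _ _ => Nat.zero_le _) (by simp; omega)
      · rw [Nat.choose_eq_zero_of_lt (by omega)]; exact Nat.zero_le _
  have h2 : ∀ s, 2 ≤ s → s + 1 < 2 ^ s := by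
    intro s hs
    induction s, hs using Nat.le_induction with
    | base => norm_num
    | succ s hs ih => rw [pow_succ]; omega
  have := h2 s (by omega)
  rw [pow_succ]; omega

lemma St.caseB (S : St G H σ u q k N Δ) (hu : dg G u = Δ) (hq : 2 ≤ q)
    (hn : 2 ^ (q + 1) ≤ Fintype.card V) : False := by
  have hbig := S.Dbig hu
  have hcl : ∀ x x', dg G x = Δ → dg G x' = Δ → x ≠ x' → G.Adj x x' := by
    intro x x' hx hx' hne
    by_contra hadj
    obtain ⟨j, hj⟩ := S.ap hu _ x hx le_rfl
    obtain ⟨j', hj'⟩ := S.ap hu _ x' hx' le_rfl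
    rcases le_total j j' with h | h
    · obtain ⟨d, rfl⟩ := Nat.exists_eq_add_of_le h
      exact S.clique hu d x x' hx hx' hne hadj (by rw [hj', hj]; ring)
    · obtain ⟨d, rfl⟩ := Nat.exists_eq_add_of_le h
      exact S.clique hu d x' x hx' hx hne.symm (fun h => hadj h.symm) (by rw [hj', hj]; ring)
  obtain ⟨y0, hy1, hy2, hy3⟩ := S.b0 hu
  set D := univ.filter (fun x => dg G x = Δ) with hD
  set L := univ.filter (fun x => ¬ dg G x = Δ) with hL
  have hDL : D.card + L.card = Fintype.card V := card_filter_add_card_filter_not _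
  set c := Fintype.card V - 1 - Δ with hc
  have hc1 : 1 ≤ c := by
    have := dg_compl G u
    have : 0 < (univ.filter (fun v => v ≠ u ∧ ¬ G.Adj u v)).card :=
      card_pos.2 ⟨y0, by simpa using ⟨hy1, fun h => hy2 h.symm⟩⟩
    omega
  have hDc : D.card ≤ (powersetCard c L).card := by
    refine card_le_card_of_injOn (fun x => univ.filter (fun v => v ≠ x ∧ ¬ G.Adj x v)) ?_ ?_
    · intro x hx
      have hx : dg G x = Δ := by simpa [hD] using hx
      rw [mem_coe, mem_powersetCard]
      constructor
      · intro v hv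
        simp only [mem_filter, mem_univ, true_and] at hv
        simp only [hL, mem_filter, mem_univ, true_and]
        intro hdv
        exact hv.2 (hcl x v hx hdv hv.1.symm)
      · have := dg_compl G x
        show (univ.filter (fun v => v ≠ x ∧ ¬ G.Adj x v)).card = c
        omega
    · intro x hx y hy hxy
      have hx : dg G x = Δ := by simpa [hD] using hx
      have hy : dg G y = Δ := by simpa [hD] using hy
      by_contra hne
      have hadj := hcl x y hx hy hne
      have hxy : ∀ z, z ≠ x → z ≠ y → (G.Adj x z ↔ G.Adj y z) := by
        intro z hzx hzy
        have h := congrArg (fun s => z ∈ s) hxy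
        simp only [mem_filter, mem_univ, true_and, hzx, hzy, ne_eq, not_false_eq_true, true_and] at h
        rw [← not_iff_not]; exact iff_of_eq h
      apply hne
      apply S.inj hu hx hy
      have := fd_iso (G := G) (H := G) (Equiv.swap x y) (r := q + 1) (x := x) (by
        intro a b
        by_cases hax : a = x
        · subst hax
          by_cases hba : b = a
          · subst hba; simp
          by_cases hby : b = y
          · subst hby; simp [G.adj_comm]
          rw [Equiv.swap_apply_left, Equiv.swap_apply_of_ne_of_ne hba hby]
          exact hxy b hba hby
        by_cases hay : a = y
        · subst hay
          by_cases hba : b = a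
          · subst hba; simp
          by_cases hby : b = x
          · subst hby; simp [G.adj_comm]
          rw [Equiv.swap_apply_right, Equiv.swap_apply_of_ne_of_ne hby hba]
          exact (hxy b hby hba).symm
        rw [Equiv.swap_apply_of_ne_of_ne hax hay]
        by_cases hbx : b = x
        · subst hbx
          rw [Equiv.swap_apply_left, G.adj_comm a b, G.adj_comm a y]
          exact hxy a hax hay
        by_cases hby : b = y
        · subst hby
          rw [Equiv.swap_apply_right, G.adj_comm a b, G.adj_comm a x]
          exact (hxy a hax hay).symm
        rw [Equiv.swap_apply_of_ne_of_ne hbx hby])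
      simpa using this
  rw [card_powersetCard] at hDc
  have hLr : L.card ≤ q + 1 := by have := S.hn; omega
  have h1 : L.card.choose c ≤ (q + 1).choose c := Nat.choose_le_choose c hLr
  have := choose_bd (q + 1) c (by omega) hc1
  omega

lemma St.false (S : St G H σ u q k N Δ) (hq : 2 ≤ q)
    (hn : 2 ^ (q + 1) ≤ Fintype.card V) : False := by
  by_cases hu : dg G u = Δ
  · exact S.caseB hu hq hn
  · exact S.caseA hu

end stepB

/-- one-sided inductive step -/
lemma step_le {G H : SimpleGraph V} {σ : V ≃ V} {u : V} (hs : Sh G H σ u) {q : ℕ} (hq : 2 ≤ q)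
    (hn : 2 ^ (q + 1) ≤ Fintype.card V) (h2 : (clq G 2).card = (clq H 2).card)
    (hc : (clq G q).card = (clq H q).card) : (clq G (q + 1)).card ≤ (clq H (q + 1)).card := by
  by_contra hlt
  push Not at hlt
  obtain ⟨k, hk⟩ := Nat.exists_eq_add_of_lt hlt
  have hqn : q + 1 + 1 < Fintype.card V := by
    have h2 : ∀ s, 3 ≤ s → s + 1 < 2 ^ s := by
      intro s hs
      induction s, hs using Nat.le_induction with
      | base => norm_num
      | succ s hs ih => rw [pow_succ]; omega
    have := h2 (q + 1) (by omega)
    omega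
  obtain ⟨N, hN⟩ := Nat.exists_eq_add_of_lt hqn
  obtain ⟨d1, d2⟩ := hs.fd_diff 2 (k := 0) (by rw [h2]; simp)
  obtain ⟨g1, g2⟩ := hs.fd_diff q (k := 0) (by rw [hc]; simp)
  obtain ⟨f1, f2⟩ := hs.fd_diff (q + 1) (k := (k : ℤ) + 1) (by rw [hk]; push_cast; ring)
  obtain ⟨m, -, hm⟩ := exists_max_image (univ : Finset V) (dg G) ⟨u, mem_univ _⟩
  refine St.false (G := G) (H := H) (σ := σ) (u := u) (q := q) (k := k + 1) (N := N + 1)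
    (Δ := dg G m) ⟨hs, by omega, by omega, by omega, ?_, ?_, ?_, ?_, hc, by omega,
      fun v => hm v (mem_univ _), ⟨m, rfl⟩⟩ hq hn
  · intro v hv; have := f1 v hv; omega
  · rw [hN] at f2
    zify; rw [f2]; push_cast; ring
  · intro v
    rw [dg_eq_fd, dg_eq_fd]
    by_cases hv : v = u
    · subst hv; simp at d2; omega
    · have := d1 v hv; omega
  · intro v
    by_cases hv : v = u
    · subst hv; simp at g2; omega
    · have := g1 v hv; omega

/-- hypotheses for the edge-count argument -/
structure Tw (G H : SimpleGraph V) (σ : V ≃ V) (u : V) (n : ℕ) : Prop where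
  sh : Sh G H σ u
  hn : Fintype.card V = n
  hn7 : 7 ≤ n
  hd : ∀ v, v ≠ u → dg G v = dg H (σ v) + 1
  hdu : dg H (σ u) + 3 = dg G u + n

noncomputable def aa (G : SimpleGraph V) (u : V) (t : ℕ) : ℕ :=
  (univ.filter (fun x => x ≠ u ∧ dg G x = t)).card
noncomputable def ee (G : SimpleGraph V) (u : V) (t : ℕ) : ℕ :=
  (univ.filter (fun x => x ≠ u ∧ dg G x = t ∧ G.Adj x u)).card
noncomputable def bb (G H : SimpleGraph V) (σ : V ≃ V) (u : V) (t : ℕ) : ℕ :=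
  (univ.filter (fun x => x ≠ u ∧ dg G x = t + 1 ∧ ¬ H.Adj (σ x) (σ u))).card

/-- number of cards in which a vertex of degree `d` has degree at least `t` -/
def qq (n t d : ℕ) : ℤ := if t < d then (n : ℤ) - 1 else if d = t then (n : ℤ) - 1 - t else 0

noncomputable def II (K : SimpleGraph V) (t : ℕ) (x v : V) : ℤ :=
  if x ≠ v ∧ t + (if K.Adj x v then 1 else 0) ≤ dg K x then 1 else 0

lemma sum_II (K : SimpleGraph V) (t : ℕ) (x : V) :
    ∑ v, II K t x v = qq (Fintype.card V) t (dg K x) := by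
  have h1 := dg_compl K x
  unfold II qq
  rw [← Finset.natCast_card_filter]
  split_ifs with h h'
  · have : (univ.filter (fun v => x ≠ v ∧ t + (if K.Adj x v then 1 else 0) ≤ dg K x)) = univ.erase x := by
      ext v
      simp only [mem_filter, mem_univ, true_and, mem_erase, and_true]
      constructor
      · rintro ⟨a, _⟩; exact a.symm
      · intro a; refine ⟨a.symm, ?_⟩; split_ifs <;> omega
    rw [this, card_erase_of_mem (mem_univ x), card_univ]
    omega
  · have : (univ.filter (fun v => x ≠ v ∧ t + (if K.Adj x v then 1 else 0) ≤ dg K x)) =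
        (univ.filter (fun v => v ≠ x ∧ ¬ K.Adj x v)) := by
      ext v
      simp only [mem_filter, mem_univ, true_and]
      constructor
      · rintro ⟨a, b⟩; refine ⟨a.symm, fun hh => ?_⟩; rw [if_pos hh] at b; omega
      · rintro ⟨a, b⟩; refine ⟨a.symm, ?_⟩; rw [if_neg b]; omega
    rw [this]; omega
  · rw [Nat.cast_eq_zero, card_eq_zero]
    ext v
    simp only [mem_filter, mem_univ, true_and, notMem_empty, iff_false, not_and, not_le]
    intro _; omega

section tw
variable {G H : SimpleGraph V} {σ : V ≃ V} {u : V} {n : ℕ}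

lemma Tw.card_II (T : Tw G H σ u n) (t : ℕ) {v : V} (hv : v ≠ u) :
    ∑ x, II G t x v = ∑ x, II H t (σ x) (σ v) := by
  obtain ⟨τ, h1, h2⟩ := T.sh v hv
  rw [Equiv.sum_comp σ (fun y => II H t y (σ v)), ← Equiv.sum_comp τ (fun y => II H t y (σ v))]
  refine sum_congr rfl fun x _ => ?_
  unfold II
  by_cases hx : x = v
  · subst hx; simp [h1]
  have h3 := dg_card_eq h2 hx
  have h4 : τ x ≠ σ v := fun e => hx (τ.injective (by rw [e, h1]))
  rw [h1] at h3
  simp only [ne_eq, hx, h4, not_false_eq_true, true_and]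
  congr 1
  apply propext
  constructor <;> intro h <;> omega

lemma Tw.master (T : Tw G H σ u n) (t : ℕ) :
    ((n : ℤ) - 2 - t) * aa G u t + ((t : ℤ) - 1) * aa G u (t + 1) + ee G u t + bb G H σ u t =
      qq n t (dg H (σ u)) - qq n t (dg G u) := by
  have h1 : ∑ v, ∑ x, (II G t x v - II H t (σ x) (σ v)) = ∑ x, (qq n t (dg G x) - qq n t (dg H (σ x))) := by
    rw [sum_comm]
    refine sum_congr rfl fun x _ => ?_
    rw [sum_sub_distrib, sum_II, Equiv.sum_comp σ (fun y => II H t (σ x) y), sum_II, T.hn]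
  rw [← add_sum_erase _ _ (mem_univ u), sum_eq_zero (s := univ.erase u), add_zero] at h1
  swap
  · intro v hv
    rw [sum_sub_distrib, T.card_II t (ne_of_mem_erase hv), sub_self]
  rw [← add_sum_erase _ _ (mem_univ u), ← add_sum_erase _ _ (mem_univ u)] at h1
  have h2 : ∑ x ∈ univ.erase u, (qq n t (dg G x) - qq n t (dg H (σ x))) -
      ∑ x ∈ univ.erase u, (II G t x u - II H t (σ x) (σ u)) =
      ((n : ℤ) - 2 - t) * aa G u t + ((t : ℤ) - 1) * aa G u (t + 1) + ee G u t + bb G H σ u t := by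
    have ea : ∀ s, (aa G u s : ℤ) = ∑ x ∈ univ.erase u, if dg G x = s then 1 else 0 := by
      intro s
      rw [← Finset.natCast_card_filter]
      unfold aa
      congr 2
      ext x; simp
    have eE : (ee G u t : ℤ) = ∑ x ∈ univ.erase u, if dg G x = t ∧ G.Adj x u then 1 else 0 := by
      rw [← Finset.natCast_card_filter]
      unfold ee
      congr 2
      ext x; simp
    have eB : (bb G H σ u t : ℤ) = ∑ x ∈ univ.erase u,
        if dg G x = t + 1 ∧ ¬ H.Adj (σ x) (σ u) then 1 else 0 := by
      rw [← Finset.natCast_card_filter]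
      unfold bb
      congr 2
      ext x; simp
    rw [ea, ea, eE, eB, mul_sum, mul_sum, ← sum_add_distrib, ← sum_add_distrib, ← sum_add_distrib,
      ← sum_sub_distrib]
    refine sum_congr rfl fun x hx => ?_
    have hxu := ne_of_mem_erase hx
    have hxw : σ x ≠ σ u := fun e => hxu (σ.injective e)
    have hdx := T.hd x hxu
    unfold II qq
    simp only [ne_eq, hxu, hxw, not_false_eq_true, true_and]
    generalize dg G x = g at *
    generalize dg H (σ x) = g' at *
    subst hdx
    by_cases hA : G.Adj x u <;> by_cases hB : H.Adj (σ x) (σ u) <;>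
      simp only [hA, hB, if_true, if_false, not_true, not_false_eq_true, and_true, and_false,
        mul_ite, mul_one, mul_zero] <;>
      split_ifs <;> omega
  have h3 : II G t u u = 0 := by simp [II]
  have h4 : II H t (σ u) (σ u) = 0 := by simp [II]
  rw [h3, h4] at h1
  linarith

lemma sum_fib_le (S : Finset V) (φ : V → ℕ) (T : Finset ℕ) :
    ∑ t ∈ T, (S.filter (fun x => φ x = t)).card ≤ S.card := by
  rw [← card_biUnion]
  · apply card_le_card
    intro x hx
    simp only [mem_biUnion, mem_filter] at hx
    obtain ⟨_, _, h, _⟩ := hx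
    exact h
  · intro a _ b _ hab
    simp only [Finset.disjoint_left, mem_filter]
    rintro x ⟨_, h⟩ ⟨_, h'⟩
    exact hab (h.symm.trans h')

lemma Tw.e_le (_T : Tw G H σ u n) (A : Finset ℕ) : ∑ t ∈ A, ee G u t ≤ dg G u := by
  refine le_trans (le_of_eq ?_) (sum_fib_le (univ.filter (fun x => G.Adj u x)) (dg G) A)
  refine sum_congr rfl fun t _ => ?_
  unfold ee
  congr 1
  ext x
  simp only [mem_filter, mem_univ, true_and]
  rw [G.adj_comm u x]
  constructor
  · rintro ⟨_, a, b⟩; exact ⟨b, a⟩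
  · rintro ⟨a, b⟩; exact ⟨a.ne, b, a⟩

lemma Tw.b_le (T : Tw G H σ u n) (A : Finset ℕ) : ∑ t ∈ A, bb G H σ u t + dg G u ≤ 2 := by
  have h0 := dg_compl H (σ u)
  have h1 := sum_fib_le (univ.filter (fun y => y ≠ σ u ∧ ¬ H.Adj (σ u) y)) (dg H) A
  have h2 : ∑ t ∈ A, bb G H σ u t = ∑ t ∈ A, ((univ.filter (fun y => y ≠ σ u ∧ ¬ H.Adj (σ u) y)).filter
      (fun y => dg H y = t)).card := by
    refine sum_congr rfl fun t _ => ?_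
    unfold bb
    refine card_equiv σ fun x => ?_
    simp only [mem_filter, mem_univ, true_and, ne_eq, EmbeddingLike.apply_eq_iff_eq]
    rw [H.adj_comm (σ u)]
    constructor
    · rintro ⟨a, b, c⟩; have := T.hd x a; exact ⟨⟨a, c⟩, by omega⟩
    · rintro ⟨⟨a, c⟩, b⟩; have := T.hd x a; exact ⟨a, by omega, c⟩
  have := T.hdu
  have := T.hn
  omega

/-- transport of card degrees -/
lemma Tw.tr (T : Tw G H σ u n) {v : V} (hv : v ≠ u) {x : V} (hx : x ≠ v) :
    ∃ y, y ≠ σ v ∧ dg G x + (if H.Adj y (σ v) then 1 else 0) = dg H y + (if G.Adj x v then 1 else 0) := by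
  obtain ⟨τ, h1, h2⟩ := T.sh v hv
  refine ⟨τ x, fun e => hx (τ.injective (by rw [e, h1])), ?_⟩
  rw [← h1]; exact dg_card_eq h2 hx

lemma Tw.tr' (T : Tw G H σ u n) {v : V} (hv : v ≠ u) {y : V} (hy : y ≠ σ v) :
    ∃ x, x ≠ v ∧ dg G x + (if H.Adj y (σ v) then 1 else 0) = dg H y + (if G.Adj x v then 1 else 0) := by
  obtain ⟨τ, h1, h2⟩ := T.sh v hv
  have hx : τ.symm y ≠ v := by rintro rfl; simp at h1; exact hy h1
  refine ⟨τ.symm y, hx, ?_⟩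
  have := dg_card_eq h2 hx
  simpa [h1] using this

lemma arith1 {n a b c : ℤ} (hn : 7 ≤ n) (ha : 0 ≤ a) (hb : 0 ≤ b) (hc : 0 ≤ c)
    (h1 : (n - 4) * a + b = n - 1) (h2 : (n - 5) * b + 2 * c = n - 1) :
    n = 7 ∧ ((a = 1 ∧ b = 3 ∧ c = 0) ∨ (a = 2 ∧ b = 0 ∧ c = 3)) := by
  have ha3 : a < 3 := by
    by_contra h
    nlinarith
  interval_cases a
  · exfalso
    have : b = n - 1 := by linarith
    subst this
    nlinarith
  · have : b = 3 := by linarith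
    subst this
    exact ⟨by omega, by left; omega⟩
  · have : n = 7 := by omega
    subst this
    exact ⟨rfl, by omega⟩

lemma aa_zero {t : ℕ} (h : aa G u t = 0) {x : V} (hx : x ≠ u) : dg G x ≠ t := by
  intro hd
  have : x ∈ univ.filter (fun x => x ≠ u ∧ dg G x = t) := by simp [hx, hd]
  rw [card_eq_zero.1 h] at this
  simp at this

lemma aa_pos {t : ℕ} (h : 0 < aa G u t) : ∃ x, x ≠ u ∧ dg G x = t := by
  obtain ⟨x, hx⟩ := card_pos.1 h
  exact ⟨x, by simpa using hx⟩

lemma aa_one {t : ℕ} (h : aa G u t = 1) {x y : V} (hx : x ≠ u) (hy : y ≠ u) (h1 : dg G x = t)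
    (h2 : dg G y = t) : x = y :=
  card_le_one.1 (le_of_eq h) x (by simp [hx, h1]) y (by simp [hy, h2])

lemma Tw.lt_card (T : Tw G H σ u n) (x : V) : dg G x < n := by
  have := dg_compl G x
  have := T.hn
  omega

lemma Tw.sp1 (T : Tw G H σ u 7) (hu : dg G u = 1) (a2 : aa G u 2 = 1)
    (a3 : aa G u 3 = 3) (a4 : aa G u 4 = 0) (e2 : ee G u 2 = 0) : False := by
  have hw : dg H (σ u) = 5 := by have := T.hdu; omega
  obtain ⟨p, hpu, hp⟩ := aa_pos (G := G) (u := u) (t := 2) (by omega)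
  have hup : ¬ G.Adj u p := by
    intro h
    have : p ∈ univ.filter (fun x => x ≠ u ∧ dg G x = 2 ∧ G.Adj x u) := by simp [hpu, hp, h.symm]
    rw [card_eq_zero.1 e2] at this
    simp at this
  obtain ⟨y, hy, hdy⟩ := T.tr hpu hpu.symm
  rw [if_neg hup] at hdy
  obtain ⟨x, rfl⟩ := σ.surjective y
  have hxp : x ≠ p := by rintro rfl; exact hy rfl
  have hxu : x ≠ u := by rintro rfl; split_ifs at hdy <;> omega
  have hdx := T.hd x hxu
  have hx2 : dg G x ≠ 2 := fun h => hxp (aa_one a2 hxu hpu h hp)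
  have hadj : H.Adj (σ x) (σ p) := by
    by_contra h; rw [if_neg h] at hdy; omega
  rw [if_pos hadj] at hdy
  -- a vertex of degree 3 not adjacent to p
  have h3 : ∃ z, z ≠ u ∧ dg G z = 3 ∧ ¬ G.Adj z p := by
    by_contra hcon
    push Not at hcon
    have : (univ.filter (fun x => x ≠ u ∧ dg G x = 3)).card ≤ (univ.filter (fun x => G.Adj p x)).card := by
      apply card_le_card
      intro z hz
      simp only [mem_filter, mem_univ, true_and] at hz ⊢
      exact (hcon z hz.1 hz.2).symm
    have h' : aa G u 3 ≤ dg G p := this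
    omega
  obtain ⟨z, hzu, hz3, hzp⟩ := h3
  obtain ⟨y', hy', hdy'⟩ := T.tr hpu (x := z) (by rintro rfl; omega)
  rw [if_neg hzp] at hdy'
  obtain ⟨x', rfl⟩ := σ.surjective y'
  have hxu' : x' ≠ u := by rintro rfl; split_ifs at hdy' <;> omega
  have hdx' := T.hd x' hxu'
  have hx4 := aa_zero a4 hxu'
  have hadj' : H.Adj (σ x') (σ p) := by
    by_contra h; rw [if_neg h] at hdy'; omega
  rw [if_pos hadj'] at hdy'
  have hdp := T.hd p hpu
  have h1 : (univ.filter (fun x => H.Adj (σ p) x)).card ≤ 1 := by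
    have : dg H (σ p) ≤ 1 := by omega
    exact this
  have := card_le_one.1 h1 (σ x) (by simpa using hadj.symm) (σ x') (by simpa using hadj'.symm)
  rw [this] at hdy
  omega

lemma Tw.sp2 (T : Tw G H σ u 7) (hu : dg G u = 1) (a1 : aa G u 1 = 0) (a2 : aa G u 2 = 2)
    (a3 : aa G u 3 = 0) (a5 : aa G u 5 = 1) (a6 : aa G u 6 = 0)
    (e5 : ee G u 5 = 1) : False := by
  have hw : dg H (σ u) = 5 := by have := T.hdu; omega
  obtain ⟨p, hp⟩ := card_pos.1 (show 0 < ee G u 5 by omega)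
  simp only [mem_filter, mem_univ, true_and] at hp
  obtain ⟨hpu, hp5, hpa⟩ := hp
  have hne5 : ∀ x, x ≠ u → x ≠ p → dg G x ≠ 5 := fun x hx hxp h => hxp (aa_one a5 hx hpu h hp5)
  have hwp : σ u ≠ σ p := fun e => hpu (σ.injective e).symm
  obtain ⟨x, hx, hdx⟩ := T.tr' hpu hwp
  have hxu : x ≠ u := by
    rintro rfl
    rw [if_pos hpa.symm] at hdx
    split_ifs at hdx <;> omega
  have hx5 := hne5 x hxu hx
  have hx6 := aa_zero a6 hxu
  have hx3 := T.lt_card x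
  have hadj : H.Adj (σ u) (σ p) := by
    by_contra h; rw [if_neg h] at hdx
    split_ifs at hdx <;> omega
  rw [if_pos hadj] at hdx
  have hxp : ¬ G.Adj x p := by
    intro h; rw [if_pos h] at hdx; omega
  rw [if_neg hxp] at hdx
  have hx4 : dg G x = 4 := by omega
  have sole : ∀ z, z ≠ p → ¬ G.Adj z p → z = x := by
    have h0 := dg_compl G p
    rw [T.hn] at h0
    have h1 : (univ.filter (fun v => v ≠ p ∧ ¬ G.Adj p v)).card ≤ 1 := by omega
    intro z hz hzp
    exact card_le_one.1 h1 z (by simp only [mem_filter, mem_univ, true_and]; exact ⟨hz, fun h => hzp h.symm⟩)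
      x (by simp only [mem_filter, mem_univ, true_and]; exact ⟨hx, fun h => hxp h.symm⟩)
  -- a neighbour of σ p of degree 3 in H
  have h3 : ∃ z, z ≠ u ∧ H.Adj (σ z) (σ p) ∧ dg G z ≠ 2 := by
    by_contra hcon
    push Not at hcon
    have h4 : (univ.filter (fun y => H.Adj (σ p) y)).card ≤
        (insert (σ u) ((univ.filter (fun x => x ≠ u ∧ dg G x = 2)).map σ.toEmbedding)).card := by
      apply card_le_card
      intro y hy
      simp only [mem_filter, mem_univ, true_and] at hy
      obtain ⟨z, rfl⟩ := σ.surjective y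
      rw [mem_insert]
      by_cases hzu : z = u
      · left; rw [hzu]
      · right
        rw [mem_map]
        exact ⟨z, by simpa using ⟨hzu, hcon z hzu hy.symm⟩, rfl⟩
    have h5 := card_insert_le (σ u) ((univ.filter (fun x => x ≠ u ∧ dg G x = 2)).map σ.toEmbedding)
    rw [card_map] at h5
    have h6 : dg H (σ p) ≤ aa G u 2 + 1 := le_trans h4 h5
    have := T.hd p hpu
    omega
  obtain ⟨z, hzu, hza, hz2⟩ := h3
  have hzp : z ≠ p := by rintro rfl; exact H.irrefl hza
  have hz1 := aa_zero a1 hzu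
  have hz3 := aa_zero a3 hzu
  have hz5 := hne5 z hzu hzp
  have hz6 := aa_zero a6 hzu
  have hz7 := T.lt_card z
  have hdz := T.hd z hzu
  have hz4 : dg G z = 4 := by omega
  obtain ⟨s, hs, hds⟩ := T.tr' hpu (y := σ z) (fun e => hzp (σ.injective e))
  rw [if_pos hza] at hds
  have hsu : s ≠ u := by
    rintro rfl
    rw [if_pos hpa.symm] at hds
    omega
  have hs3 := aa_zero a3 hsu
  by_cases hsp : G.Adj s p
  · rw [if_pos hsp] at hds; omega
  · rw [if_neg hsp] at hds
    have := sole s hs hsp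
    subst this
    omega

lemma qq_gt {n t d : ℕ} (h : t < d) : qq n t d = n - 1 := by simp [qq, h]
lemma qq_eq {n t d : ℕ} (h : d = t) : qq n t d = n - 1 - t := by simp [qq, h]
lemma qq_lt {n t d : ℕ} (h : d < t) : qq n t d = 0 := by
  unfold qq; rw [if_neg (by omega), if_neg (by omega)]

lemma Tw.d0 (T : Tw G H σ u n) (hd : dg G u = 0) : False := by
  have hn7 := T.hn7
  have hdu := T.hdu
  have M1 := T.master 1
  have M2 := T.master 2
  have M3 := T.master 3
  have M4 := T.master 4
  have E := T.e_le
  have B := T.b_le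
  rw [hd] at M1 M2 M3 M4
  rw [qq_gt (by omega), qq_lt (by omega)] at M1 M2 M3
  push_cast at M1 M2 M3 M4
  have e1 := E {1, 2}
  have e2 := E {1, 3}
  have e3 := E {1, 4}
  have b1 := B {1, 2}
  have b2 := B {1, 3}
  have b3 := B {1, 4}
  rw [sum_pair (by norm_num)] at e1 e2 e3 b1 b2 b3
  norm_num at M1 M2 M3 M4
  have ha : aa G u 1 = 1 := by
    rcases Nat.lt_trichotomy (aa G u 1) 1 with h | h | h
    · have : aa G u 1 = 0 := by omega
      rw [this] at M1; push_cast at M1; omega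
    · exact h
    · exfalso
      have : (2 : ℤ) ≤ aa G u 1 := by exact_mod_cast h
      have h7 : (7 : ℤ) ≤ n := by exact_mod_cast hn7
      nlinarith
  rw [ha] at M1
  have hbb : bb G H σ u 1 = 2 := by push_cast at M1; omega
  obtain ⟨h7, h⟩ := arith1 (n := n) (a := aa G u 2) (b := aa G u 3) (c := aa G u 4)
    (by omega) (by omega) (by omega) (by omega) (by linarith) (by linarith)
  have h7 : n = 7 := by exact_mod_cast h7
  subst h7
  rw [qq_eq (by omega), qq_lt (by omega)] at M4
  push_cast at M4
  omega

lemma Tw.d2 (T : Tw G H σ u n) (hd : dg G u = 2) : False := by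
  have hn7 := T.hn7
  have hdu := T.hdu
  obtain ⟨m, rfl⟩ : ∃ m, n = m + 4 := ⟨n - 4, by omega⟩
  have M1 := T.master (m + 2)
  have M2 := T.master (m + 1)
  have M3 := T.master m
  have M4 := T.master 2
  have E := T.e_le
  have B := T.b_le
  rw [hd] at M1 M2 M3 M4
  rw [qq_gt (by omega), qq_lt (by omega)] at M1 M2 M3
  rw [qq_gt (by omega), qq_eq (by omega)] at M4
  have e1 := E {m + 2, m + 1}
  have e2 := E {m + 2, m}
  have e3 := E {m + 2, 2}
  have b1 := B {m + 2, m + 1}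
  have b2 := B {m + 2, m}
  have b3 := B {m + 2, 2}
  rw [sum_pair (by omega)] at e1 e2 e3 b1 b2 b3
  have M1' : ((m : ℤ) + 1) * aa G u (m + 2 + 1) + ee G u (m + 2) + bb G H σ u (m + 2) = m + 3 := by
    push_cast at M1; linarith
  clear M1
  have M1 := M1'
  have ha : aa G u (m + 2 + 1) = 1 := by
    rcases Nat.lt_trichotomy (aa G u (m + 2 + 1)) 1 with h | h | h
    · have : aa G u (m + 2 + 1) = 0 := by omega
      rw [this] at M1; push_cast at M1; omega
    · exact h
    · exfalso
      have : (2 : ℤ) ≤ aa G u (m + 2 + 1) := by exact_mod_cast h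
      have h7 : (3 : ℤ) ≤ m := by exact_mod_cast (by omega)
      push_cast at M1
      nlinarith
  rw [ha] at M1
  have hbb : ee G u (m + 2) = 2 := by push_cast at M1; omega
  have z1 : ee G u (m + 1) = 0 ∧ bb G H σ u (m + 1) = 0 := by omega
  have z2 : ee G u m = 0 ∧ bb G H σ u m = 0 := by omega
  rw [z1.1, z1.2] at M2
  rw [z2.1, z2.2] at M3
  push_cast at M2 M3
  obtain ⟨h7, h⟩ := arith1 (n := (m : ℤ) + 4) (a := aa G u (m + 1 + 1)) (b := aa G u (m + 1)) (c := aa G u m)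
    (by omega) (by omega) (by omega) (by omega) (by linarith) (by linarith)
  have h7 : m = 3 := by omega
  subst h7
  push_cast at M4
  norm_num at M4 h
  omega

lemma Tw.d1 (T : Tw G H σ u n) (hd : dg G u = 1) : False := by
  have hn7 := T.hn7
  have hdu := T.hdu
  obtain ⟨m, rfl⟩ : ∃ m, n = m + 2 := ⟨n - 2, by omega⟩
  have M0 := T.master m
  have M1 := T.master 1
  have M2 := T.master 2
  have M3 := T.master 3
  have M4 := T.master 4
  have E := T.e_le
  have B := T.b_le
  rw [hd] at M0 M1 M2 M3 M4
  rw [qq_gt (by omega), qq_lt (by omega)] at M2 M3 M4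
  rw [qq_gt (by omega), qq_eq (by omega)] at M1
  rw [qq_eq (by omega), qq_lt (by omega)] at M0
  have e1 := E {1, m, 2}
  have e2 := E {1, m, 3}
  have e3 := E {1, m, 4}
  have b1 := B {1, m, 2}
  have b2 := B {1, m, 3}
  have b3 := B {1, m, 4}
  rw [sum_insert (by simp; omega), sum_pair (by omega)] at e1 e2 e3 b1 b2 b3
  push_cast at M0 M1 M2 M3 M4
  norm_num at M1 M2 M3 M4
  have h5 : (5 : ℤ) ≤ m := by exact_mod_cast (by omega)
  have ha : aa G u 1 = 0 := by
    by_contra h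
    have : (1 : ℤ) ≤ aa G u 1 := by exact_mod_cast Nat.one_le_iff_ne_zero.2 h
    nlinarith
  have ha' : aa G u (m + 1) = 0 := by
    by_contra h
    have : (1 : ℤ) ≤ aa G u (m + 1) := by exact_mod_cast Nat.one_le_iff_ne_zero.2 h
    nlinarith
  rw [ha] at M1
  rw [ha'] at M0
  push_cast at M0 M1
  have M0' : (ee G u m : ℤ) + bb G H σ u m = 1 := by linarith
  have M1' : (ee G u 1 : ℤ) + bb G H σ u 1 = 1 := by linarith
  clear M0 M1
  have he1 : ee G u 1 = 0 := by
    have : ee G u 1 ≤ aa G u 1 := by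
      apply card_le_card
      intro x hx
      simp only [mem_filter, mem_univ, true_and] at hx ⊢
      exact ⟨hx.1, hx.2.1⟩
    omega
  have hb1 : bb G H σ u 1 = 1 := by omega
  have hem : ee G u m = 1 := by omega
  have z2 : ee G u 2 = 0 ∧ bb G H σ u 2 = 0 := by omega
  have z3 : ee G u 3 = 0 ∧ bb G H σ u 3 = 0 := by omega
  have z4 : ee G u 4 = 0 ∧ bb G H σ u 4 = 0 := by omega
  rw [z2.1, z2.2] at M2
  rw [z3.1, z3.2] at M3
  rw [z4.1, z4.2] at M4
  push_cast at M2 M3 M4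
  clear e1 e2 e3 b1 b2 b3 E B M0' M1' hb1 he1
  obtain ⟨h7, h⟩ := arith1 (n := (m : ℤ) + 2) (a := aa G u 2) (b := aa G u 3) (c := aa G u 4)
    (by linarith) (Int.natCast_nonneg _) (Int.natCast_nonneg _) (Int.natCast_nonneg _)
    (by linarith) (by linarith)
  have h7 : (m : ℤ) = 5 := by linarith
  rw [h7] at M4
  have h44 : (aa G u 4 : ℤ) + 3 * aa G u 5 = 6 := by linarith
  clear M2 M3 M4
  have h7 : m = 5 := by exact_mod_cast h7
  rw [h7] at T ha' hem
  have T7 : Tw G H σ u 7 := T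
  have i6 : aa G u 6 = 0 := ha'
  clear ha' T
  rcases h with ⟨h2, h3, h4⟩ | ⟨h2, h3, h4⟩
  · have i2 : aa G u 2 = 1 := by exact_mod_cast h2
    have i3 : aa G u 3 = 3 := by exact_mod_cast h3
    have i4 : aa G u 4 = 0 := by exact_mod_cast h4
    exact T7.sp1 hd i2 i3 i4 z2.1
  · have i2 : aa G u 2 = 2 := by exact_mod_cast h2
    have i3 : aa G u 3 = 0 := by exact_mod_cast h3
    have i5 : (aa G u 5 : ℤ) = 1 := by linarith
    have i5 : aa G u 5 = 1 := by exact_mod_cast i5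
    exact T7.sp2 hd ha i2 i3 i5 i6 hem

lemma Tw.false (T : Tw G H σ u n) : False := by
  have hdu := T.hdu
  have hb0 := T.b_le ∅
  simp only [sum_empty] at hb0
  obtain h | h | h : dg G u = 0 ∨ dg G u = 1 ∨ dg G u = 2 := by omega
  · exact T.d0 h
  · exact T.d1 h
  · exact T.d2 h

end tw

lemma edges_le {G H : SimpleGraph V} {σ : V ≃ V} {u : V} (hs : Sh G H σ u)
    (hn : 7 ≤ Fintype.card V) : (clq G 2).card ≤ (clq H 2).card := by
  by_contra hlt
  push Not at hlt
  obtain ⟨k, hk⟩ := Nat.exists_eq_add_of_lt hlt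
  obtain ⟨f1, f2⟩ := hs.fd_diff 2 (k := (k : ℤ) + 1) (by rw [hk]; push_cast; ring)
  have hw := dg_compl H (σ u)
  rw [← dg_eq_fd, ← dg_eq_fd] at f2
  obtain ⟨m, hm⟩ : ∃ m, Fintype.card V = m + 7 := ⟨Fintype.card V - 7, by omega⟩
  have hk0 : k = 0 := by
    by_contra h
    have h1 : (1 : ℤ) ≤ k := by exact_mod_cast Nat.one_le_iff_ne_zero.2 h
    have h2 : (dg H (σ u) : ℤ) ≤ m + 6 := by exact_mod_cast (by omega)
    rw [hm] at f2
    push_cast at f2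
    have h3 : (0 : ℤ) ≤ dg G u := by omega
    have h4 : (0 : ℤ) ≤ m := by omega
    nlinarith
  subst hk0
  refine Tw.false (G := G) (H := H) (σ := σ) (u := u) ⟨hs, rfl, hn, ?_, ?_⟩
  · intro v hv
    have := f1 v hv
    rw [dg_eq_fd, dg_eq_fd]; push_cast at this; omega
  · push_cast at f2; omega

lemma edges_eq {G H : SimpleGraph V} {σ : V ≃ V} {u : V} (hs : Sh G H σ u)
    (hn : 7 ≤ Fintype.card V) : (clq G 2).card = (clq H 2).card :=
  le_antisymm (edges_le hs hn) (edges_le hs.symm hn)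

lemma clq_one (G : SimpleGraph V) : (clq G 1).card = Fintype.card V := by
  have h : clq G 1 = univ.map ⟨fun x : V => ({x} : Finset V), singleton_injective⟩ := by
    ext s
    rw [mem_clq]
    simp only [mem_map, mem_univ, true_and, Function.Embedding.coeFn_mk]
    constructor
    · rintro ⟨_, h⟩; obtain ⟨x, rfl⟩ := card_eq_one.1 h; exact ⟨x, rfl⟩
    · rintro ⟨x, rfl⟩; simp
  rw [h, card_map, card_univ]

lemma clq_eq {G H : SimpleGraph V} {σ : V ≃ V} {u : V} (hs : Sh G H σ u)
    (hn : 7 ≤ Fintype.card V) : ∀ r, 1 ≤ r → 2 ^ r ≤ Fintype.card V →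
      (clq G r).card = (clq H r).card := by
  intro r hr
  induction r, hr using Nat.le_induction with
  | base => intro _; rw [clq_one, clq_one]
  | succ q hq ih =>
    intro h
    have h2 := edges_eq hs hn
    by_cases hq1 : q = 1
    · subst hq1; exact h2
    have hc := ih (by rw [pow_succ] at h; omega)
    exact le_antisymm (step_le hs (by omega) h h2 hc) (step_le hs.symm (by omega) h h2.symm hc.symm)

lemma kappa_eq_clq (G : SimpleGraph V) (r : ℕ) : kappa G r = (clq G r).card := by
  unfold kappa
  rw [← Set.ncard_coe_finset]
  congr 1
  ext s
  simp [clq, SimpleGraph.mem_cliqueSet_iff]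

lemma ci_of_iso {G H : SimpleGraph V} {v v' : V} (φ : gcard G v ≃g gcard H v') : CI G H v v' := by
  let τ : V ≃ V := (Equiv.optionSubtypeNe v).symm.trans
    ((Equiv.optionCongr φ.toEquiv).trans (Equiv.optionSubtypeNe v'))
  have hτ : ∀ x (hx : x ≠ v), τ x = (φ ⟨x, hx⟩).1 := by
    intro x hx
    simp [τ, Equiv.optionSubtypeNe_symm_of_ne hx]
  refine ⟨τ, by simp [τ], fun x y hx hy => ?_⟩
  rw [hτ x hx, hτ y hy]
  exact (φ.map_rel_iff (a := ⟨x, hx⟩) (b := ⟨y, hy⟩)).symm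

lemma sh_of_share {n : ℕ} {G H : SimpleGraph (Fin n)} (h : ShareCards G H) :
    ∃ σ u, Sh G H σ u := by
  obtain ⟨u, w, π, h⟩ := h
  let σ : Fin n ≃ Fin n := (Equiv.optionSubtypeNe u).symm.trans
    ((Equiv.optionCongr π).trans (Equiv.optionSubtypeNe w))
  have hσ : ∀ x (hx : x ≠ u), σ x = (π ⟨x, hx⟩).1 := by
    intro x hx
    simp [σ, Equiv.optionSubtypeNe_symm_of_ne hx]
  refine ⟨σ, u, fun v hv => ?_⟩
  obtain ⟨φ⟩ := h ⟨v, hv⟩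
  rw [hσ v hv]
  exact ci_of_iso φ

end Aux

theorem clique_count_of_small_r {n : ℕ} (hn : 7 ≤ n)
    (G H : SimpleGraph (Fin n)) (hshare : ShareCards G H)
    (r : ℕ) (hr : 1 ≤ r) (hrn : 2 ^ r ≤ n) :
    kappa G r = kappa H r := by
  obtain ⟨σ, u, hs⟩ := sh_of_share hshare
  rw [kappa_eq_clq, kappa_eq_clq]
  exact clq_eq hs (by simpa using hn) r hr (by simpa using hrn)
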